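/- Let n ≥ 0, let q, λ, μ ∈ ℂ with q nonzero and not a root of unity, λ ≠ 0, and let s ∈ ℤ_{≥0}^n, α ∈ ℤ_{≥0}^{n+1} with (μ;q)_{|s|} ≠ 0 and (μ;q)_{|α|} ≠ 0. Then Σ_{m ∈ ℤ_{≥0}^n, m ≤ s} q^{φ(m,α) + Σ_{i=1}^n α_i m_i} Φ_q^{(n)}(m|s;λ,μ) = Σ_{γ ∈ ℤ_{≥0}^{n+1}, γ ≤ α} q^{φ(γ,α) + φ(s,γ) − φ(α,γ) + Σ_{i=1}^n s_i γ_i} Φ_q^{(n+1)}(γ|α;λ,μ), where in φ(m,α) and φ(s,γ) the length-n vector is padded with a trailing zero to length n+1. -/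

import Mathlib

/-- The q-Pochhammer symbol `(z;q)_m = ∏_{j=0}^{m-1} (1 - z q^j)`. -/
noncomputable def qPoch (q z : ℂ) (m : ℕ) : ℂ := ∏ j ∈ Finset.range m, (1 - z * q ^ j)

/-- The q-binomial coefficient `binom(m,k)_q`. -/
noncomputable def qBinom (q : ℂ) (m k : ℕ) : ℂ :=
  if k ≤ m then qPoch q q m / (qPoch q q k * qPoch q q (m - k)) else 0

/-- `q` is not a root of unity. -/
def notRootOfUnity (q : ℂ) : Prop := ∀ m : ℕ, 0 < m → q ^ m ≠ 1

/-- `φ(β,γ) = Σ_{1 ≤ i < j ≤ k} β_i γ_j` for integer vectors. -/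
def phi {k : ℕ} (β γ : Fin k → ℤ) : ℤ :=
  ∑ i, ∑ j, if i < j then β i * γ j else 0

open Classical in
/-- The weight `Φ_q^{(n)}(γ|β;λ,μ)` of the stochastic R matrix of `U_q(A^{(1)}_n)`. -/
noncomputable def Phi (n : ℕ) (q lam mu : ℂ) (γ β : Fin n → ℕ) : ℂ :=
  if γ ≤ β then
    q ^ phi (fun i => (β i : ℤ) - (γ i : ℤ)) (fun i => (γ i : ℤ))
      * (mu / lam) ^ (∑ i, γ i)
      * qPoch q lam (∑ i, γ i) * qPoch q (mu / lam) ((∑ i, β i) - ∑ i, γ i)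
      * (∏ i, qBinom q (β i) (γ i)) / qPoch q mu (∑ i, β i)
  else 0

lemma qPoch_succ (q z : ℂ) (m : ℕ) : qPoch q z (m + 1) = qPoch q z m * (1 - z * q ^ m) :=
  Finset.prod_range_succ _ _

lemma qPoch_zero (q z : ℂ) : qPoch q z 0 = 1 := rfl

lemma qPoch_self_ne_zero {q : ℂ} (hq : notRootOfUnity q) (m : ℕ) : qPoch q q m ≠ 0 := by
  refine Finset.prod_ne_zero_iff.2 fun j _ h => hq (j + 1) j.succ_pos ?_
  rw [pow_succ']
  exact (sub_eq_zero.1 h).symm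

lemma qBinom_zero_right {q : ℂ} (hq : notRootOfUnity q) (m : ℕ) : qBinom q m 0 = 1 := by
  simp [qBinom, qPoch_zero, div_self (qPoch_self_ne_zero hq m)]

lemma qBinom_of_lt (q : ℂ) {m k : ℕ} (h : m < k) : qBinom q m k = 0 :=
  if_neg (not_le.2 h)

/-- The `q`-Pascal rule. -/
lemma qBinom_succ_succ {q : ℂ} (hq : notRootOfUnity q) (m k : ℕ) :
    qBinom q (m + 1) (k + 1) = qBinom q m k + q ^ (k + 1) * qBinom q m (k + 1) := by
  have hne := qPoch_self_ne_zero hq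
  rcases lt_trichotomy m k with h | rfl | h
  · simp [qBinom_of_lt q h, qBinom_of_lt q (h.trans k.lt_succ_self),
      qBinom_of_lt q (Nat.succ_lt_succ h)]
  · simp [qBinom, qPoch_zero, div_self (hne _)]
  · obtain ⟨j, rfl⟩ := Nat.exists_eq_add_of_lt h
    have e₁ : k + j + 1 + 1 - (k + 1) = j + 1 := by omega
    have e₂ : k + j + 1 - k = j + 1 := by omega
    have e₃ : k + j + 1 - (k + 1) = j := by omega
    have hk := hne (k + 1)
    have hj := hne (j + 1)
    simp only [qBinom, e₁, e₂, e₃, if_pos (show k + 1 ≤ k + j + 1 + 1 by omega),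
      if_pos (show k ≤ k + j + 1 by omega), if_pos (show k + 1 ≤ k + j + 1 by omega)]
    rw [qPoch_succ q q (k + j + 1)]
    rw [qPoch_succ] at hk hj
    rw [qPoch_succ q q k, qPoch_succ q q j]
    obtain ⟨hk₁, hk₂⟩ := mul_ne_zero_iff.1 hk
    obtain ⟨hj₁, hj₂⟩ := mul_ne_zero_iff.1 hj
    field_simp
    ring

lemma phi_succ {k : ℕ} (β γ : Fin (k + 1) → ℤ) :
    phi β γ = β 0 * ∑ i : Fin k, γ i.succ + phi (fun i => β i.succ) (fun i => γ i.succ) := by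
  simp [phi, Fin.sum_univ_succ, Finset.mul_sum]

lemma phi_sub_left {k : ℕ} (β β' γ : Fin k → ℤ) :
    phi (fun i => β i - β' i) γ = phi β γ - phi β' γ := by
  simp only [phi, ← Finset.sum_sub_distrib]
  refine Finset.sum_congr rfl fun i _ => Finset.sum_congr rfl fun j _ => ?_
  split_ifs <;> ring

lemma phi_sub_right {k : ℕ} (β γ γ' : Fin k → ℤ) :
    phi β (fun i => γ i - γ' i) = phi β γ - phi β γ' := by
  simp only [phi, ← Finset.sum_sub_distrib]
  refine Finset.sum_congr rfl fun i _ => Finset.sum_congr rfl fun j _ => ?_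
  split_ifs <;> ring

lemma sum_Iic_fin_succ {M : Type*} [AddCommMonoid M] {n : ℕ} (s : Fin (n + 1) → ℕ)
    (f : (Fin (n + 1) → ℕ) → M) :
    ∑ m ∈ Finset.Iic s, f m
      = ∑ a ∈ Finset.range (s 0 + 1), ∑ m ∈ Finset.Iic (fun i => s (Fin.succ i)),
          f (Fin.cons a m) := by
  rw [← Finset.sum_product']
  refine Finset.sum_bij' (fun m _ => (m 0, fun i => m (Fin.succ i)))
    (fun p _ => Fin.cons p.1 p.2) ?_ ?_ ?_ ?_ ?_
  · intro m hm
    rw [Finset.mem_Iic] at hm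
    simpa [Nat.lt_succ_iff] using ⟨hm 0, fun i => hm (Fin.succ i)⟩
  · rintro ⟨a, m⟩ h
    simp only [Finset.mem_product, Finset.mem_range, Nat.lt_succ_iff, Finset.mem_Iic] at h ⊢
    intro i
    induction i using Fin.cases with
    | zero => exact h.1
    | succ i => exact h.2 i
  · intro m _
    exact Fin.cons_self_tail m
  · intro p _
    simp
  · intro m _
    exact congrArg f (Fin.cons_self_tail m).symm

section QPlane

variable {A : Type*} [Ring A] [Algebra ℂ A] {q : ℂ} {U V : A}

lemma mul_pow_of_qcomm (h : U * V = q • (V * U)) (k : ℕ) :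
    U * V ^ k = q ^ k • (V ^ k * U) := by
  induction k with
  | zero => simp
  | succ k ih =>
    rw [pow_succ, ← mul_assoc, ih, smul_mul_assoc, mul_assoc, h, mul_smul_comm, smul_smul,
      mul_assoc, pow_succ]

lemma pow_mul_pow_of_qcomm (h : U * V = q • (V * U)) (l k : ℕ) :
    U ^ l * V ^ k = q ^ (l * k) • (V ^ k * U ^ l) := by
  induction l with
  | zero => simp
  | succ l ih =>
    rw [pow_succ', mul_assoc, ih, mul_smul_comm, ← mul_assoc, mul_pow_of_qcomm h,
      smul_mul_assoc, smul_smul, mul_assoc, ← pow_add]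
    congr 2
    ring

/-- The noncommutative `q`-binomial theorem. -/
lemma add_smul_pow_of_qcomm (hq : notRootOfUnity q) (h : U * V = q • (V * U)) (x : ℂ) (s : ℕ) :
    (U + x • V) ^ s
      = ∑ k ∈ Finset.range (s + 1), (qBinom q s k * x ^ k) • (V ^ k * U ^ (s - k)) := by
  induction s with
  | zero => simp [qBinom_zero_right hq]
  | succ s ih =>
    have hU : U * (U + x • V) ^ s = ∑ k ∈ Finset.range (s + 1 + 1),
        (q ^ k * qBinom q s k * x ^ k) • (V ^ k * U ^ (s + 1 - k)) := by
      rw [Finset.sum_range_succ, qBinom_of_lt q s.lt_succ_self, ih, Finset.mul_sum]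
      simp only [mul_zero, zero_mul, zero_smul, add_zero]
      refine Finset.sum_congr rfl fun k hk => ?_
      rw [Nat.succ_sub (Nat.lt_succ_iff.1 (Finset.mem_range.1 hk)), mul_smul_comm, ← mul_assoc,
        mul_pow_of_qcomm h, smul_mul_assoc, smul_smul, mul_assoc (V ^ k), pow_succ']
      congr 1
      ring
    rw [pow_succ', add_mul, hU, ih, Finset.sum_range_succ', Finset.sum_range_succ' _ (s + 1),
      Finset.mul_sum, add_right_comm, ← Finset.sum_add_distrib]
    congr 1
    · refine Finset.sum_congr rfl fun k _ => ?_
      rw [qBinom_succ_succ hq, Nat.add_sub_add_right, smul_mul_smul_comm, ← mul_assoc V,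
        ← pow_succ', ← add_smul]
      congr 1
      ring
    · simp [qBinom_zero_right hq]

/-- Normal ordering of a product of powers of `U + x i • V`, in increasing order of `i`. -/
lemma sum_Iic_smul_eq_prod (hq0 : q ≠ 0) (hq : notRootOfUnity q) (h : U * V = q • (V * U))
    {n : ℕ} (x : Fin n → ℂ) (s : Fin n → ℕ) :
    ∑ m ∈ Finset.Iic s,
      (q ^ phi (fun i => (s i : ℤ) - (m i : ℤ)) (fun i => (m i : ℤ))
        * (∏ i, x i ^ m i) * ∏ i, qBinom q (s i) (m i))
          • (V ^ (∑ i, m i) * U ^ ((∑ i, s i) - ∑ i, m i))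
      = (List.ofFn fun i => (U + x i • V) ^ s i).prod := by
  induction n with
  | zero =>
    have : Finset.Iic s = {s} := by ext; simp [Subsingleton.elim _ s]
    simp [this, phi]
  | succ n ih =>
    rw [sum_Iic_fin_succ, List.ofFn_succ, List.prod_cons, ← ih, add_smul_pow_of_qcomm hq h,
      Finset.sum_mul_sum]
    refine Finset.sum_congr rfl fun a ha => Finset.sum_congr rfl fun m hm => ?_
    have ha' : a ≤ s 0 := Nat.lt_succ_iff.1 (Finset.mem_range.1 ha)
    have hm' : ∑ i, m i ≤ ∑ i : Fin n, s i.succ :=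
      Finset.sum_le_sum fun i _ => Finset.mem_Iic.1 hm i
    simp only [phi_succ, Fin.sum_univ_succ, Fin.prod_univ_succ, Fin.cons_zero, Fin.cons_succ]
    rw [smul_mul_smul_comm, mul_assoc (V ^ a), ← mul_assoc (U ^ _), pow_mul_pow_of_qcomm h,
      smul_mul_assoc, mul_smul_comm, smul_smul, mul_assoc (V ^ _), ← mul_assoc (V ^ a),
      ← pow_add, ← pow_add, tsub_add_tsub_comm ha' hm']
    congr 1
    rw [zpow_add₀ hq0, ← Nat.cast_sub ha', ← Nat.cast_sum, ← Nat.cast_mul, zpow_natCast]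
    ring

/-- Normal ordering of a product of powers of `U + x i • V`, in decreasing order of `i`. -/
lemma sum_Iic_smul_eq_reverse_prod (hq0 : q ≠ 0) (hq : notRootOfUnity q)
    (h : U * V = q • (V * U)) {n : ℕ} (x : Fin n → ℂ) (s : Fin n → ℕ) :
    ∑ m ∈ Finset.Iic s,
      (q ^ phi (fun i => (m i : ℤ)) (fun i => (s i : ℤ) - (m i : ℤ))
        * (∏ i, x i ^ m i) * ∏ i, qBinom q (s i) (m i))
          • (V ^ (∑ i, m i) * U ^ ((∑ i, s i) - ∑ i, m i))
      = (List.ofFn fun i => (U + x i • V) ^ s i).reverse.prod := by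
  induction n with
  | zero =>
    have : Finset.Iic s = {s} := by ext; simp [Subsingleton.elim _ s]
    simp [this, phi]
  | succ n ih =>
    rw [sum_Iic_fin_succ, List.ofFn_succ, List.reverse_cons, List.prod_append,
      List.prod_singleton, ← ih, add_smul_pow_of_qcomm hq h, Finset.sum_mul_sum,
      Finset.sum_comm]
    refine Finset.sum_congr rfl fun m hm => Finset.sum_congr rfl fun a ha => ?_
    have ha' : a ≤ s 0 := Nat.lt_succ_iff.1 (Finset.mem_range.1 ha)
    have hm' : ∑ i, m i ≤ ∑ i : Fin n, s i.succ :=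
      Finset.sum_le_sum fun i _ => Finset.mem_Iic.1 hm i
    simp only [phi_succ, Fin.sum_univ_succ, Fin.prod_univ_succ, Fin.cons_zero, Fin.cons_succ]
    rw [smul_mul_smul_comm, mul_assoc (V ^ _) (U ^ _), ← mul_assoc (U ^ _),
      pow_mul_pow_of_qcomm h, smul_mul_assoc, mul_smul_comm, smul_smul, mul_assoc (V ^ a),
      ← mul_assoc (V ^ _), ← pow_add, ← pow_add, add_comm _ a, add_comm (_ - _) (s 0 - a),
      tsub_add_tsub_comm ha' hm']
    congr 1
    rw [zpow_add₀ hq0, Finset.sum_sub_distrib, ← Nat.cast_sum, ← Nat.cast_sum,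
      ← Nat.cast_sub hm', ← Nat.cast_mul, zpow_natCast]
    ring

lemma add_pow_smul_exchange (h : U * V = q • (V * U)) (N b : ℕ) :
    (U + q ^ (N + 1) • V) * (U + q ^ b • V) = (U + q ^ (b + 1) • V) * (U + q ^ N • V) := by
  simp only [add_mul, mul_add, smul_mul_assoc, mul_smul_comm, h]
  module

lemma add_pow_smul_exchange_pow (h : U * V = q • (V * U)) (N b c : ℕ) :
    (U + q ^ (N + c) • V) * (U + q ^ b • V) ^ c
      = (U + q ^ (b + 1) • V) ^ c * (U + q ^ N • V) := by
  induction c generalizing N with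
  | zero => simp
  | succ c ih =>
    rw [pow_succ (U + q ^ b • V), ← mul_assoc, show N + (c + 1) = N + 1 + c by ring, ih,
      mul_assoc, add_pow_smul_exchange h, ← mul_assoc, ← pow_succ]

lemma add_pow_smul_exchange_reverse_prod (h : U * V = q • (V * U)) (N : ℕ) {n : ℕ}
    (b c : Fin n → ℕ) :
    (U + q ^ (N + ∑ i, c i) • V) * (List.ofFn fun i => (U + q ^ b i • V) ^ c i).reverse.prod
      = (List.ofFn fun i => (U + q ^ (b i + 1) • V) ^ c i).reverse.prod * (U + q ^ N • V) := by
  induction n generalizing N with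
  | zero => simp
  | succ n ih =>
    simp only [List.ofFn_succ, List.reverse_cons, List.prod_append, List.prod_singleton]
    rw [← mul_assoc, Fin.sum_univ_succ, ← add_assoc, ih, mul_assoc, add_pow_smul_exchange_pow h,
      mul_assoc]

end QPlane

section Action

variable {M : Type*} [AddCommGroup M] [Module ℂ M] {q : ℂ} {U V : Module.End ℂ M} {v : M}

lemma reverse_prod_shift (h : U * V = q • (V * U)) (hv : (U + V) v = v) {n : ℕ}
    (b c : Fin n → ℕ) (a : ℕ) :
    (List.ofFn fun i => (U + q ^ (a + b i) • V) ^ c i).reverse.prod v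
      = ((U + q ^ (∑ i, c i) • V) ^ a
          * (List.ofFn fun i => (U + q ^ b i • V) ^ c i).reverse.prod) v := by
  induction a with
  | zero => simp
  | succ a ih =>
    have key := congrArg (· v)
      (add_pow_smul_exchange_reverse_prod h 0 (fun i => a + b i) c)
    simp only [zero_add, pow_zero, one_smul, Module.End.mul_apply, hv] at key
    rw [pow_succ', mul_assoc, Module.End.mul_apply, ← ih, key]
    simp only [add_right_comm]

/-- Conjugation symmetry: the powers of `q` in the two products are the parts of a partition
and of its conjugate. -/
lemma prod_apply_eq_reverse_prod_apply (h : U * V = q • (V * U)) (hv : (U + V) v = v) {n : ℕ}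
    (s : Fin n → ℕ) (α : Fin (n + 1) → ℕ) :
    (List.ofFn fun i : Fin n =>
        (U + q ^ (∑ j, if i.castSucc ≤ j then α j else 0) • V) ^ s i).prod v
      = (List.ofFn fun j : Fin (n + 1) =>
        (U + q ^ (∑ i : Fin n, if i.castSucc ≤ j then s i else 0) • V) ^ α j).reverse.prod v := by
  have hpow : ∀ k, ((U + V) ^ k) v = v := fun k => by
    induction k with
    | zero => simp
    | succ k ih => rw [pow_succ, Module.End.mul_apply, hv, ih]
  induction n with
  | zero => simp [hpow]
  | succ n ih =>
    have e : ∀ j : Fin (n + 2), (∑ i : Fin (n + 1), if i.castSucc ≤ j then s i else 0)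
        = s 0 + (Fin.cons 0 (fun j' : Fin (n + 1) =>
            ∑ i : Fin n, if i.castSucc ≤ j' then s i.succ else 0) : Fin (n + 2) → ℕ) j := by
      intro j
      induction j using Fin.cases <;> simp [Fin.sum_univ_succ]
    simp only [e]
    rw [reverse_prod_shift h hv]
    rw [List.ofFn_succ, List.ofFn_succ (n := n + 1)]
    simp only [List.reverse_cons, List.prod_append, List.prod_cons, List.prod_nil, mul_one,
      Module.End.mul_apply, Fin.cons_zero, Fin.cons_succ, pow_zero, one_smul, hpow]
    rw [← ih]
    simp [Fin.sum_univ_succ (n := n + 1)]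

/-- The weights of `Phi` as moments of a linear functional. -/
lemma moment_eq (hq0 : q ≠ 0) (h : U * V = q • (V * U)) (hv : (U + V) v = v)
    {lam mu nu : ℂ} (hmu : mu = nu * lam) (E : M →ₗ[ℂ] ℂ)
    (hE : ∀ l, E ((U ^ l) v) = qPoch q nu l / qPoch q mu l) (k l : ℕ)
    (hne : qPoch q mu (k + l) ≠ 0) :
    E ((V ^ k * U ^ l) v) = nu ^ k * qPoch q lam k * qPoch q nu l / qPoch q mu (k + l) := by
  induction k generalizing l with
  | zero => simp [hE, qPoch_zero]
  | succ k ih =>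
    have hne' := hne
    rw [show k + 1 + l = k + l + 1 by ring, qPoch_succ] at hne'
    obtain ⟨h₁, h₂⟩ := mul_ne_zero_iff.1 hne'
    have hsplit : (V ^ k * U ^ l) v
        = (V ^ k * U ^ (l + 1)) v + q ^ l • (V ^ (k + 1) * U ^ l) v := by
      have := pow_mul_pow_of_qcomm h l 1
      rw [mul_one, pow_one] at this
      conv_lhs => rw [← hv]
      rw [← Module.End.mul_apply, mul_add, mul_assoc, mul_assoc, ← pow_succ, this,
        mul_smul_comm, ← mul_assoc, ← pow_succ]
      rfl
    have hE' := congrArg E hsplit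
    rw [map_add, map_smul, ih l h₁, ih (l + 1) (by rwa [← add_assoc, qPoch_succ]),
      smul_eq_mul] at hE'
    have hql := pow_ne_zero l hq0
    refine mul_left_cancel₀ hql ?_
    rw [eq_sub_of_add_eq' hE'.symm, show k + 1 + l = k + l + 1 by ring, show k + (l + 1) = k + l + 1 by ring,
      qPoch_succ, qPoch_succ, qPoch_succ]
    field_simp
    rw [hmu]
    ring

end Action

/-- A representation of the quantum plane on polynomials that realises the moments above. -/
lemma exists_qPlane_module {q : ℂ} (hq0 : q ≠ 0) (e : ℕ → ℂ) :
    ∃ (U V : Module.End ℂ (Polynomial ℂ)) (v : Polynomial ℂ) (E : Polynomial ℂ →ₗ[ℂ] ℂ),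
      U * V = q • (V * U) ∧ (U + V) v = v ∧ ∀ l, E ((U ^ l) v) = e l := by
  let T : Polynomial ℂ →ₐ[ℂ] Polynomial ℂ := Polynomial.aeval (q⁻¹ • Polynomial.X)
  refine ⟨LinearMap.mulLeft ℂ Polynomial.X,
    LinearMap.mulLeft ℂ (1 - Polynomial.X) * T.toLinearMap, 1,
    Polynomial.lsum fun l => LinearMap.mulLeft ℂ (e l), ?_, ?_, fun l => ?_⟩
  · refine LinearMap.ext fun f => ?_
    simp [T, smul_smul, hq0]
    ring
  · simp
  · simp [LinearMap.pow_mulLeft, Polynomial.lsum_apply, Polynomial.X_pow_eq_monomial]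

lemma phi_snoc_left_add_sum {n : ℕ} (m : Fin n → ℕ) (c : Fin (n + 1) → ℕ) :
    phi (fun i => ((Fin.snoc m 0 : Fin (n + 1) → ℕ) i : ℤ)) (fun i => (c i : ℤ))
        + ∑ i : Fin n, (m i : ℤ) * c i.castSucc
      = ∑ i : Fin n, ∑ j, if i.castSucc ≤ j then (m i : ℤ) * c j else 0 := by
  rw [phi, Fin.sum_univ_castSucc]
  simp only [Fin.snoc_castSucc, Fin.snoc_last, Nat.cast_zero, zero_mul, ite_self,
    Finset.sum_const_zero, add_zero, ← Finset.sum_add_distrib]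
  refine Finset.sum_congr rfl fun i _ => ?_
  rw [← Finset.sum_erase_add _ _ (Finset.mem_univ i.castSucc),
    ← Finset.sum_erase_add Finset.univ (fun j => if i.castSucc ≤ j then _ else _)
      (Finset.mem_univ i.castSucc)]
  simp only [lt_irrefl, le_refl, if_true, if_false, add_zero]
  congr 1
  refine Finset.sum_congr rfl fun j hj => ?_
  simp only [(Finset.ne_of_mem_erase hj).symm.le_iff_lt]

lemma prod_pow_sum_eq_zpow (q : ℂ) {ι κ : Type*} [Fintype ι] [Fintype κ] (r : ι → κ → Prop)
    [∀ i j, Decidable (r i j)] (m : ι → ℕ) (c : κ → ℕ) :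
    ∏ i, (q ^ (∑ j, if r i j then c j else 0)) ^ m i
      = q ^ (∑ i, ∑ j, if r i j then (m i : ℤ) * c j else 0) := by
  rw [show (∑ i, ∑ j, if r i j then (m i : ℤ) * c j else 0)
      = ((∑ i, (∑ j, if r i j then c j else 0) * m i : ℕ) : ℤ) by
    push_cast
    simp only [Finset.mul_sum, mul_ite, mul_zero, mul_comm (∑ j, _) (_ : ℤ)], zpow_natCast,
    ← Finset.prod_pow_eq_pow_sum]
  simp only [pow_mul]

/-- The key summation identity (eq. (lin) of Kuniba–Okado):
`Σ_{m ≤ s} q^{φ(m,α) + Σ α_i m_i} Φ_q^{(n)}(m|s;λ,μ)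
  = Σ_{γ ≤ α} q^{φ(γ,α) + φ(s,γ) − φ(α,γ) + Σ s_i γ_i} Φ_q^{(n+1)}(γ|α;λ,μ)`,
where length-`n` vectors are padded with a trailing zero to length `n+1` inside `φ`. -/
theorem key_identity (n : ℕ) (q lam mu : ℂ) (hq0 : q ≠ 0) (hq : notRootOfUnity q)
    (hlam : lam ≠ 0) (s : Fin n → ℕ) (α : Fin (n + 1) → ℕ)
    (hs : qPoch q mu (∑ i, s i) ≠ 0) (hα : qPoch q mu (∑ i, α i) ≠ 0) :
    ∑ m ∈ Finset.Iic s,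
      q ^ (phi (fun i => ((Fin.snoc m 0 : Fin (n + 1) → ℕ) i : ℤ)) (fun i => (α i : ℤ))
            + ∑ i : Fin n, (α i.castSucc : ℤ) * m i)
        * Phi n q lam mu m s
    = ∑ γ ∈ Finset.Iic α,
        q ^ (phi (fun i => (γ i : ℤ)) (fun i => (α i : ℤ))
              + phi (fun i => ((Fin.snoc s 0 : Fin (n + 1) → ℕ) i : ℤ)) (fun i => (γ i : ℤ))
              - phi (fun i => (α i : ℤ)) (fun i => (γ i : ℤ))
              + ∑ i : Fin n, (s i : ℤ) * γ i.castSucc)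
          * Phi (n + 1) q lam mu γ α := by
  have hmu : mu = mu / lam * lam := (div_mul_cancel₀ mu hlam).symm
  obtain ⟨U, V, v, E, hUV, hv, hE⟩ :=
    exists_qPlane_module hq0 fun l => qPoch q (mu / lam) l / qPoch q mu l
  have hmom {k l N : ℕ} (hkl : k + l = N) (hN : qPoch q mu N ≠ 0) :=
    moment_eq hq0 hUV hv hmu E hE k l (hkl ▸ hN)
  have hsymm := congrArg E (prod_apply_eq_reverse_prod_apply hUV hv s α)
  rw [← sum_Iic_smul_eq_prod hq0 hq hUV, ← sum_Iic_smul_eq_reverse_prod hq0 hq hUV] at hsymm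
  simp only [LinearMap.sum_apply, map_sum, LinearMap.smul_apply, map_smul, smul_eq_mul] at hsymm
  convert hsymm using 1
  · refine Finset.sum_congr rfl fun m hm => ?_
    have hms := Finset.mem_Iic.1 hm
    have hle : ∑ i, m i ≤ ∑ i, s i := Finset.sum_le_sum fun i _ => hms i
    have hadd := Nat.add_sub_cancel' hle
    rw [hmom hadd hs, hadd, prod_pow_sum_eq_zpow, ← phi_snoc_left_add_sum, Phi, if_pos hms]
    simp only [mul_comm (α _ : ℤ)]
    ring
  · refine Finset.sum_congr rfl fun γ hγ => ?_
    have hγα := Finset.mem_Iic.1 hγ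
    have hle : ∑ i, γ i ≤ ∑ i, α i := Finset.sum_le_sum fun i _ => hγα i
    have hadd := Nat.add_sub_cancel' hle
    rw [hmom hadd hα, hadd, prod_pow_sum_eq_zpow, Finset.sum_comm]
    simp only [mul_comm (γ _ : ℤ)]
    rw [← phi_snoc_left_add_sum, Phi, if_pos hγα, phi_sub_left, phi_sub_right]
    simp only [zpow_add₀ hq0, zpow_sub₀ hq0]
    field_simp
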